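/- Let h : Δ(2,3,8) → ℤ/2ℤ be the group homomorphism determined by h(x) = 1 and h(y) = 0. Then the subgroup of Δ(2,3,8) generated by the set of all squares {t² : t ∈ Δ(2,3,8)} is equal to ker(h); consequently this subgroup of squares is isomorphic to the triangle group Δ(3,3,4). -/

import Mathlib

set_option synthInstance.maxHeartbeats 1000000
set_option maxHeartbeats 1000000
set_option linter.unusedVariables false
noncomputable section
open Quaternion

/-- The relations of the `(2,3,8)` triangle group `⟨x, y ∣ x² = y³ = (xy)⁸ = 1⟩`. -/
def rels238 : Set (FreeGroup (Fin 2)) :=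
  {FreeGroup.of 0 ^ 2, FreeGroup.of 1 ^ 3, (FreeGroup.of 0 * FreeGroup.of 1) ^ 8}

/-- The `(2,3,8)` triangle group. -/
abbrev Δ238 : Type := PresentedGroup rels238

/-- The generator `x` of `Δ(2,3,8)`. -/
def xΔ : Δ238 := PresentedGroup.of 0

/-- The generator `y` of `Δ(2,3,8)`. -/
def yΔ : Δ238 := PresentedGroup.of 1

/-- The relations of the `(3,3,4)` triangle group `⟨a, b ∣ a³ = b³ = (ab)⁴ = 1⟩`. -/
def rels334 : Set (FreeGroup (Fin 2)) :=
  {FreeGroup.of 0 ^ 3, FreeGroup.of 1 ^ 3, (FreeGroup.of 0 * FreeGroup.of 1) ^ 4}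

/-- The `(3,3,4)` triangle group. -/
abbrev Δ334 : Type := PresentedGroup rels334

/-- The generator `a` of `Δ(3,3,4)`. -/
def aΔ : Δ334 := PresentedGroup.of 0

/-- The generator `b` of `Δ(3,3,4)`. -/
def bΔ : Δ334 := PresentedGroup.of 1

theorem xx : xΔ * xΔ = 1 := by
  have := PresentedGroup.one_of_mem (rels := rels238) (x := FreeGroup.of 0 ^ 2) (by simp [rels238])
  rw [map_pow, pow_two] at this
  exact this

theorem y3 : yΔ ^ 3 = 1 := by
  have := PresentedGroup.one_of_mem (rels := rels238) (x := FreeGroup.of 1 ^ 3) (by simp [rels238])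
  rw [map_pow] at this
  exact this

theorem xy8 : (xΔ * yΔ) ^ 8 = 1 := by
  have := PresentedGroup.one_of_mem (rels := rels238)
    (x := (FreeGroup.of 0 * FreeGroup.of 1) ^ 8) (by simp [rels238])
  rw [map_pow, map_mul] at this
  exact this

theorem a3 : aΔ ^ 3 = 1 := by
  have := PresentedGroup.one_of_mem (rels := rels334) (x := FreeGroup.of 0 ^ 3) (by simp [rels334])
  rw [map_pow] at this
  exact this

theorem b3 : bΔ ^ 3 = 1 := by
  have := PresentedGroup.one_of_mem (rels := rels334) (x := FreeGroup.of 1 ^ 3) (by simp [rels334])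
  rw [map_pow] at this
  exact this

theorem ab4 : (aΔ * bΔ) ^ 4 = 1 := by
  have := PresentedGroup.one_of_mem (rels := rels334)
    (x := (FreeGroup.of 0 * FreeGroup.of 1) ^ 4) (by simp [rels334])
  rw [map_pow, map_mul] at this
  exact this

theorem ba4 : (bΔ * aΔ) ^ 4 = 1 := by
  have h : bΔ * aΔ = aΔ⁻¹ * (aΔ * bΔ) * aΔ⁻¹⁻¹ := by group
  rw [h, conj_pow, ab4]
  group

/-- Homomorphisms out of `Δ334`. -/
theorem lift334 {G : Type} [Group G] (u v : G) (hu : u ^ 3 = 1) (hv : v ^ 3 = 1)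
    (huv : (u * v) ^ 4 = 1) : ∃ f : Δ334 →* G, f aΔ = u ∧ f bΔ = v := by
  refine ⟨PresentedGroup.toGroup (f := ![u, v]) ?_, ?_, ?_⟩
  · intro r hr
    rcases hr with rfl | rfl | rfl <;> simpa
  · simp [aΔ, PresentedGroup.toGroup.of]
  · simp [bΔ, PresentedGroup.toGroup.of]

/-- Homomorphisms out of `Δ238`. -/
theorem lift238 {G : Type} [Group G] (u v : G) (hu : u ^ 2 = 1) (hv : v ^ 3 = 1)
    (huv : (u * v) ^ 8 = 1) : ∃ f : Δ238 →* G, f xΔ = u ∧ f yΔ = v := by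
  refine ⟨PresentedGroup.toGroup (f := ![u, v]) ?_, ?_, ?_⟩
  · intro r hr
    rcases hr with rfl | rfl | rfl <;> simpa
  · simp [xΔ, PresentedGroup.toGroup.of]
  · simp [yΔ, PresentedGroup.toGroup.of]

theorem ext334 {G : Type} [Group G] (f g : Δ334 →* G) (ha : f aΔ = g aΔ) (hb : f bΔ = g bΔ) :
    f = g := by
  apply PresentedGroup.ext
  intro i
  fin_cases i
  · exact ha
  · exact hb

theorem exists_swap334 : ∃ σ : MulAut Δ334, σ aΔ = bΔ ∧ σ bΔ = aΔ := by
  obtain ⟨f, fa, fb⟩ := lift334 bΔ aΔ b3 a3 ba4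
  have hf : f.comp f = MonoidHom.id _ := by
    apply ext334 <;> simp [fa, fb]
  exact ⟨MonoidHom.toMulEquiv f f hf hf, fa, fb⟩

theorem exists_emb : ∃ f : Δ334 →* Δ238, f aΔ = xΔ * yΔ * xΔ ∧ f bΔ = yΔ ∧
    Function.Injective f := by
  have hxi : xΔ⁻¹ = xΔ := inv_eq_of_mul_eq_one_left xx
  obtain ⟨f, fa, fb⟩ := lift334 (xΔ * yΔ * xΔ) yΔ
    (by
      have : xΔ * yΔ * xΔ = xΔ * yΔ * xΔ⁻¹ := by rw [hxi]
      rw [this, conj_pow, y3]; group)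
    y3
    (by
      have : xΔ * yΔ * xΔ * yΔ = (xΔ * yΔ) ^ 2 := by rw [pow_two]; group
      rw [this, ← pow_mul]; exact xy8)
  refine ⟨f, fa, fb, ?_⟩
  obtain ⟨σ, sa, sb⟩ := exists_swap334
  have hσ : σ * σ = 1 := by
    have : (σ * σ).toMonoidHom = (1 : MulAut Δ334).toMonoidHom := by
      apply ext334 <;> simp [sa, sb]
    ext t
    exact DFunLike.congr_fun this t
  let X : SemidirectProduct Δ334 (MulAut Δ334) (MonoidHom.id _) := SemidirectProduct.inr σ
  let Y : SemidirectProduct Δ334 (MulAut Δ334) (MonoidHom.id _) := SemidirectProduct.inl bΔ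
  have hX : X * X = 1 := by
    show SemidirectProduct.inr σ * SemidirectProduct.inr σ = _
    rw [← map_mul, hσ, map_one]
  have hXYX : X * Y * X = SemidirectProduct.inl aΔ := by
    ext <;> simp [X, Y, sb, hσ]
  obtain ⟨g, gx, gy⟩ := lift238 X Y (by rw [pow_two, hX])
    (by rw [← map_pow, b3, map_one])
    (by
      have : (X * Y) ^ 8 = ((X * Y * X) * Y) ^ 4 := by
        rw [show 8 = 2 * 4 from rfl, pow_mul, pow_two]; simp only [mul_assoc]
      rw [this, hXYX, ← map_mul, ← map_pow, ab4, map_one])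
  have hgf : g.comp f = SemidirectProduct.inl := by
    apply ext334
    · simp [fa, gx, gy, hXYX]
    · simp [fb, gy, Y]
  have : Function.Injective (g.comp f) := by
    rw [hgf]; exact SemidirectProduct.inl_injective
  exact Function.Injective.of_comp (f := g) (by simpa using this)

/-- The subgroup of `Δ(2,3,8)` generated by all squares equals the kernel of the
homomorphism `h : Δ(2,3,8) → ℤ/2ℤ` with `h(x) = 1`, `h(y) = 0`; consequently this
subgroup of squares is isomorphic to the triangle group `Δ(3,3,4)`. -/
theorem stmt_1 (h : Δ238 →* Multiplicative (ZMod 2))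
    (hx : h xΔ = Multiplicative.ofAdd 1) (hy : h yΔ = Multiplicative.ofAdd 0) :
    Subgroup.closure {t : Δ238 | ∃ s : Δ238, t = s ^ 2} = h.ker ∧
    Nonempty (↥(Subgroup.closure {t : Δ238 | ∃ s : Δ238, t = s ^ 2}) ≃* Δ334) := by
  obtain ⟨f, fa, fb, finj⟩ := exists_emb
  set S := Subgroup.closure {t : Δ238 | ∃ s : Δ238, t = s ^ 2} with hS
  have hsq : ∀ s : Δ238, s ^ 2 ∈ S := fun s => Subgroup.subset_closure ⟨s, rfl⟩
  have hxi : xΔ⁻¹ = xΔ := inv_eq_of_mul_eq_one_left xx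
  have hyi : yΔ⁻¹ = yΔ ^ 2 := inv_eq_of_mul_eq_one_left (by rw [← pow_succ, y3])
  have h1 : S ≤ h.ker := by
    rw [hS, Subgroup.closure_le]
    rintro _ ⟨s, rfl⟩
    show h (s ^ 2) = 1
    rw [map_pow]
    generalize h s = z
    revert z
    decide
  have h2 : f.range ≤ S := by
    have hyS : yΔ ∈ S := by
      have := S.inv_mem (hsq yΔ)
      rwa [← hyi, inv_inv] at this
    have hxyx : xΔ * yΔ * xΔ ∈ S := by
      have e : xΔ * yΔ * xΔ = (xΔ * yΔ) ^ 2 * yΔ⁻¹ := by rw [pow_two]; group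
      rw [e]
      exact S.mul_mem (hsq _) (S.inv_mem hyS)
    rintro _ ⟨t, rfl⟩
    have ht : t ∈ Subgroup.closure (Set.range (PresentedGroup.of (rels := rels334))) := by
      rw [PresentedGroup.closure_range_of]; trivial
    have hle : Subgroup.closure (Set.range (PresentedGroup.of (rels := rels334))) ≤ S.comap f := by
      rw [Subgroup.closure_le]
      rintro _ ⟨i, rfl⟩
      fin_cases i
      · show f aΔ ∈ S
        rw [fa]; exact hxyx
      · show f bΔ ∈ S
        rw [fb]; exact hyS
    exact hle ht
  have hyR : yΔ ∈ f.range := ⟨bΔ, fb⟩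
  have hxR : xΔ * yΔ * xΔ ∈ f.range := ⟨aΔ, fa⟩
  have hstepx : ∀ g : Δ238, (g ∈ f.range ∨ xΔ * g ∈ f.range) →
      (xΔ * g ∈ f.range ∨ xΔ * (xΔ * g) ∈ f.range) := by
    intro g hg
    rw [← mul_assoc, xx, one_mul]
    exact hg.symm
  have hstepy : ∀ g : Δ238, (g ∈ f.range ∨ xΔ * g ∈ f.range) →
      (yΔ * g ∈ f.range ∨ xΔ * (yΔ * g) ∈ f.range) := by
    rintro g (hg | hg)
    · exact Or.inl (mul_mem hyR hg)
    · right
      have e : xΔ * (yΔ * g) = (xΔ * yΔ * xΔ) * (xΔ * g) := by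
        have : (xΔ * yΔ * xΔ) * (xΔ * g) = xΔ * yΔ * (xΔ * xΔ) * g := by group
        rw [this, xx]; group
      rw [e]
      exact mul_mem hxR hg
  have hall : ∀ g : Δ238, g ∈ f.range ∨ xΔ * g ∈ f.range := by
    intro g
    have hg : g ∈ Subgroup.closure (Set.range (PresentedGroup.of (rels := rels238))) := by
      rw [PresentedGroup.closure_range_of]; trivial
    induction hg using Subgroup.closure_induction_left with
    | one => exact Or.inl (one_mem _)
    | mul_left u hu v hv ih =>
      obtain ⟨i, rfl⟩ := hu
      fin_cases i
      · exact hstepx v ih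
      · exact hstepy v ih
    | inv_mul_cancel u hu v hv ih =>
      obtain ⟨i, rfl⟩ := hu
      fin_cases i
      · show xΔ⁻¹ * v ∈ f.range ∨ xΔ * (xΔ⁻¹ * v) ∈ f.range
        rw [hxi]
        exact hstepx v ih
      · show yΔ⁻¹ * v ∈ f.range ∨ xΔ * (yΔ⁻¹ * v) ∈ f.range
        rw [hyi, pow_two, mul_assoc]
        exact hstepy _ (hstepy v ih)
  have h3 : h.ker ≤ f.range := by
    intro g hg
    rcases hall g with h' | h'
    · exact h'
    · exfalso
      have e : h (xΔ * g) = 1 := h1 (h2 h')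
      have e2 : h g = 1 := hg
      rw [map_mul, hx, e2] at e
      revert e
      decide
  have hSR : f.range = S := le_antisymm h2 (h1.trans h3)
  refine ⟨le_antisymm h1 (h3.trans h2), ⟨?_⟩⟩
  rw [← hSR]
  exact (MonoidHom.ofInjective finj).symm
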